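/- Suppose a protocol routes a quantum system Q maximally entangled with a reference Q̄ (of dimension d), producing a pure state on Q̄ABR such that both I(Q̄:AR) = 2 log d and I(Q̄:BR) = 2 log d. Then S(R) ≥ log d. -/

import Mathlib

open scoped BigOperators ComplexOrder

noncomputable section

namespace QI

/-- The von Neumann entropy of a matrix: `-∑ λᵢ log λᵢ` over its eigenvalues when the
matrix is Hermitian (and `0` otherwise). -/
def vnEntropy {n : Type*} [Fintype n] [DecidableEq n] (ρ : Matrix n n ℂ) : ℝ :=
  if h : ρ.IsHermitian then ∑ i, Real.negMulLog (h.eigenvalues i) else 0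

/-- The density matrix `|ψ⟩⟨ψ|` of a pure state vector `ψ`. -/
def pureDensity {n : Type*} (ψ : n → ℂ) : Matrix n n ℂ :=
  Matrix.vecMulVec ψ (star ψ)

variable {Q A B R : Type*} [Fintype Q] [Fintype A] [Fintype B] [Fintype R]

/-- Reduced state on `Q̄` of a state on `Q̄ × A × B × R`. -/
def redQ (ρ : Matrix (Q × A × B × R) (Q × A × B × R) ℂ) : Matrix Q Q ℂ :=
  Matrix.of fun p q => ∑ a, ∑ b, ∑ r, ρ (p, a, b, r) (q, a, b, r)

/-- Reduced state on `R` of a state on `Q̄ × A × B × R`. -/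
def redR (ρ : Matrix (Q × A × B × R) (Q × A × B × R) ℂ) : Matrix R R ℂ :=
  Matrix.of fun p q => ∑ x, ∑ a, ∑ b, ρ (x, a, b, p) (x, a, b, q)

/-- Reduced state on `A × R`. -/
def redAR (ρ : Matrix (Q × A × B × R) (Q × A × B × R) ℂ) : Matrix (A × R) (A × R) ℂ :=
  Matrix.of fun p q => ∑ x, ∑ b, ρ (x, p.1, b, p.2) (x, q.1, b, q.2)

/-- Reduced state on `B × R`. -/
def redBR (ρ : Matrix (Q × A × B × R) (Q × A × B × R) ℂ) : Matrix (B × R) (B × R) ℂ :=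
  Matrix.of fun p q => ∑ x, ∑ a, ρ (x, a, p.1, p.2) (x, a, q.1, q.2)

/-- Reduced state on `Q̄ × A × R`. -/
def redQAR (ρ : Matrix (Q × A × B × R) (Q × A × B × R) ℂ) :
    Matrix (Q × A × R) (Q × A × R) ℂ :=
  Matrix.of fun p q => ∑ b, ρ (p.1, p.2.1, b, p.2.2) (q.1, q.2.1, b, q.2.2)

/-- Reduced state on `Q̄ × B × R`. -/
def redQBR (ρ : Matrix (Q × A × B × R) (Q × A × B × R) ℂ) :
    Matrix (Q × B × R) (Q × B × R) ℂ :=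
  Matrix.of fun p q => ∑ a, ρ (p.1, a, p.2.1, p.2.2) (q.1, a, q.2.1, q.2.2)

open scoped Kronecker Matrix

section Entropy

variable {m n : Type*} [Fintype m] [Fintype n] [DecidableEq m] [DecidableEq n]

lemma vnEntropy_eq_sum_roots {ρ : Matrix n n ℂ} (h : ρ.IsHermitian) :
    vnEntropy ρ = (ρ.charpoly.roots.map fun z => Real.negMulLog z.re).sum := by
  rw [vnEntropy, dif_pos h, h.roots_charpoly_eq_eigenvalues, Multiset.map_map]
  rfl

lemma vnEntropy_congr_charpoly {ρ σ : Matrix n n ℂ} (hρ : ρ.IsHermitian) (hσ : σ.IsHermitian)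
    (h : ρ.charpoly = σ.charpoly) : vnEntropy ρ = vnEntropy σ := by
  rw [vnEntropy_eq_sum_roots hρ, vnEntropy_eq_sum_roots hσ, h]

lemma vnEntropy_transpose {ρ : Matrix n n ℂ} (h : ρ.IsHermitian) :
    vnEntropy ρᵀ = vnEntropy ρ :=
  vnEntropy_congr_charpoly h.transpose h ρ.charpoly_transpose

/-- The two Gram matrices of a rectangular matrix have the same entropy, since their nonzero
spectra agree. -/
lemma vnEntropy_mul_conjTranspose_self (M : Matrix m n ℂ) :
    vnEntropy (M * Mᴴ) = vnEntropy (Mᴴ * M) := by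
  rw [vnEntropy_eq_sum_roots (Matrix.isHermitian_mul_conjTranspose_self M),
    vnEntropy_eq_sum_roots (Matrix.isHermitian_conjTranspose_mul_self M)]
  have h := congrArg (fun p : Polynomial ℂ =>
    (p.roots.map fun z => Real.negMulLog z.re).sum) (Matrix.charpoly_mul_comm' M Mᴴ)
  have hm (k : ℕ) : (Polynomial.X : Polynomial ℂ) ^ k * (M * Mᴴ).charpoly ≠ 0 :=
    mul_ne_zero (pow_ne_zero _ Polynomial.X_ne_zero) (M * Mᴴ).charpoly_monic.ne_zero
  have hn (k : ℕ) : (Polynomial.X : Polynomial ℂ) ^ k * (Mᴴ * M).charpoly ≠ 0 :=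
    mul_ne_zero (pow_ne_zero _ Polynomial.X_ne_zero) (Mᴴ * M).charpoly_monic.ne_zero
  simpa [Polynomial.roots_mul (hm _), Polynomial.roots_mul (hn _), Multiset.map_nsmul,
    Multiset.sum_nsmul] using h

lemma vnEntropy_unitary_conj {ρ : Matrix n n ℂ} (h : ρ.IsHermitian) {U : Matrix n n ℂ}
    (hU : U * Uᴴ = 1) : vnEntropy (Uᴴ * ρ * U) = vnEntropy ρ := by
  refine vnEntropy_congr_charpoly (Matrix.isHermitian_conjTranspose_mul_mul U h) h ?_
  rw [Matrix.charpoly_mul_comm, ← mul_assoc, hU, one_mul]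

lemma vnEntropy_inv_card_smul_one :
    vnEntropy ((Fintype.card n : ℂ)⁻¹ • (1 : Matrix n n ℂ)) = Real.log (Fintype.card n) := by
  have hs : (Fintype.card n : ℂ)⁻¹ • (1 : Matrix n n ℂ)
      = Matrix.diagonal fun _ => (Fintype.card n : ℂ)⁻¹ := by
    rw [Matrix.smul_one_eq_diagonal]
  have hh : (Matrix.diagonal fun _ : n => (Fintype.card n : ℂ)⁻¹).IsHermitian :=
    Matrix.isHermitian_diagonal_iff.2 fun _ => by simp [IsSelfAdjoint]
  rw [hs, vnEntropy_eq_sum_roots hh, Matrix.charpoly_diagonal, Finset.prod_const,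
    Polynomial.roots_pow, Polynomial.roots_X_sub_C, Multiset.map_nsmul, Multiset.sum_nsmul]
  have hre : ((Fintype.card n : ℂ)⁻¹).re = (Fintype.card n : ℝ)⁻¹ := by
    rw [← Complex.ofReal_natCast, ← Complex.ofReal_inv, Complex.ofReal_re]
  rcases Nat.eq_zero_or_pos (Fintype.card n) with h0 | h0
  · simp [h0]
  · have : (Fintype.card n : ℝ) ≠ 0 := by positivity
    simp only [Multiset.map_singleton, Multiset.sum_singleton, hre, Real.negMulLog, Real.log_inv,
      nsmul_eq_mul, Finset.card_univ]
    field_simp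

/-- **Klein's inequality**, against a reference state diagonal in the given basis. -/
lemma vnEntropy_le_neg_sum_diag_mul_log {σ : Matrix n n ℂ} (hσ : σ.PosSemidef) {q : n → ℝ}
    (hq : ∀ i, 0 ≤ q i) (hsum : ∑ i, q i = σ.trace.re) (hzero : ∀ i, q i = 0 → (σ i i).re = 0) :
    vnEntropy σ ≤ -∑ i, (σ i i).re * Real.log (q i) := by
  have h := hσ.isHermitian
  set e := h.eigenvalues
  have he0 : ∀ k, 0 ≤ e k := hσ.eigenvalues_nonneg
  set W : Matrix n n ℂ := ↑h.eigenvectorUnitary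
  let w : n → n → ℝ := fun i k => Complex.normSq (W i k)
  have hw0 : ∀ i k, 0 ≤ w i k := fun i k => Complex.normSq_nonneg _
  have hWW : W * Wᴴ = 1 := Unitary.coe_mul_star_self h.eigenvectorUnitary
  have hWW' : Wᴴ * W = 1 := Unitary.coe_star_mul_self h.eigenvectorUnitary
  have hrow (i : n) : ∑ k, w i k = 1 := by
    have := congrArg Complex.re (congrFun (congrFun hWW i) i)
    simpa [Matrix.mul_apply, w, Complex.mul_conj] using this
  have hcol (k : n) : ∑ i, w i k = 1 := by
    have := congrArg Complex.re (congrFun (congrFun hWW' k) k)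
    simpa [Matrix.mul_apply, w, mul_comm, Complex.mul_conj] using this
  have hdiag (i : n) : (σ i i).re = ∑ k, w i k * e k := by
    have hs : σ = W * Matrix.diagonal (fun k => (e k : ℂ)) * Wᴴ := h.spectral_theorem
    have := congrArg Complex.re (congrFun (congrFun hs i) i)
    rw [this, Matrix.mul_apply, Complex.re_sum]
    refine Finset.sum_congr rfl fun k _ => ?_
    rw [Matrix.mul_diagonal, Matrix.conjTranspose_apply, mul_right_comm, Complex.star_def,
      Complex.mul_conj, ← Complex.ofReal_mul, Complex.ofReal_re]
  have hterm (i k : n) :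
      w i k * e k - w i k * q i ≤ w i k * e k * Real.log (e k) - w i k * e k * Real.log (q i) := by
    rcases (hq i).eq_or_lt with hqi | hqi
    · have hz := hzero i hqi.symm
      rw [hdiag, Finset.sum_eq_zero_iff_of_nonneg fun k _ => mul_nonneg (hw0 i k) (he0 k)] at hz
      simp [hz k (Finset.mem_univ k), ← hqi]
    rcases (he0 k).eq_or_lt with hek | hek
    · simpa [← hek] using mul_nonneg (hw0 i k) hqi.le
    have hl := Real.log_le_sub_one_of_pos (div_pos hqi hek)
    rw [Real.log_div hqi.ne' hek.ne'] at hl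
    have := mul_le_mul_of_nonneg_left hl (mul_nonneg (hw0 i k) hek.le)
    have h2 : w i k * e k * (q i / e k - 1) = w i k * q i - w i k * e k := by
      field_simp
    linarith
  have htot : ∑ i, ∑ k, (w i k * e k - w i k * q i) = 0 := by
    simp_rw [Finset.sum_sub_distrib, ← hdiag, ← Finset.sum_mul, hrow, one_mul, hsum, Matrix.trace,
      Complex.re_sum, Matrix.diag_apply, sub_self]
  have hent : ∑ i, ∑ k, w i k * e k * Real.log (e k) = -vnEntropy σ := by
    rw [Finset.sum_comm, vnEntropy, dif_pos h, ← Finset.sum_neg_distrib]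
    refine Finset.sum_congr rfl fun k _ => ?_
    simp_rw [mul_assoc, ← Finset.sum_mul, hcol, Real.negMulLog]
    ring
  have hlog : ∑ i, ∑ k, w i k * e k * Real.log (q i) = ∑ i, (σ i i).re * Real.log (q i) := by
    simp_rw [← Finset.sum_mul, ← hdiag]
  have := Finset.sum_le_sum fun i (_ : i ∈ Finset.univ) =>
    Finset.sum_le_sum fun k (_ : k ∈ Finset.univ) => hterm i k
  simp_rw [Finset.sum_sub_distrib] at this htot
  linarith

end Entropy

section PartialTrace

variable {X Y : Type*}

/-- The partial trace over the second factor. -/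
def traceRight [Fintype Y] (ρ : Matrix (X × Y) (X × Y) ℂ) : Matrix X X ℂ :=
  Matrix.of fun p q => ∑ y, ρ (p, y) (q, y)

/-- The partial trace over the first factor. -/
def traceLeft [Fintype X] (ρ : Matrix (X × Y) (X × Y) ℂ) : Matrix Y Y ℂ :=
  Matrix.of fun p q => ∑ x, ρ (x, p) (x, q)

lemma isHermitian_traceRight [Fintype Y] {ρ : Matrix (X × Y) (X × Y) ℂ} (h : ρ.IsHermitian) :
    (traceRight ρ).IsHermitian := by
  ext p q
  simp [traceRight, Matrix.conjTranspose_apply, ← h.apply (p, _) (q, _)]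

lemma isHermitian_traceLeft [Fintype X] {ρ : Matrix (X × Y) (X × Y) ℂ} (h : ρ.IsHermitian) :
    (traceLeft ρ).IsHermitian := by
  ext p q
  simp [traceLeft, Matrix.conjTranspose_apply, ← h.apply (_, p) (_, q)]

variable [Fintype X] [Fintype Y]

lemma trace_traceRight (ρ : Matrix (X × Y) (X × Y) ℂ) : (traceRight ρ).trace = ρ.trace := by
  simp [Matrix.trace, traceRight, Fintype.sum_prod_type]

lemma trace_traceLeft (ρ : Matrix (X × Y) (X × Y) ℂ) : (traceLeft ρ).trace = ρ.trace := by
  simp [Matrix.trace, traceLeft, Fintype.sum_prod_type_right]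

lemma traceRight_kronecker_conj [DecidableEq Y] (ρ : Matrix (X × Y) (X × Y) ℂ) (U : Matrix X X ℂ)
    {V : Matrix Y Y ℂ} (hV : V * Vᴴ = 1) :
    traceRight ((U ⊗ₖ V)ᴴ * ρ * (U ⊗ₖ V)) = Uᴴ * traceRight ρ * U := by
  have hδ (y y' : Y) : ∑ j, V y' j * star (V y j) = if y' = y then 1 else 0 := by
    simpa [Matrix.mul_apply, Matrix.one_apply] using congrFun (congrFun hV y') y
  ext i i'
  calc _ = ∑ x', ∑ y', ∑ x, ∑ y,
        star (U x i) * ρ (x, y) (x', y') * U x' i' * ∑ j, V y' j * star (V y j) := by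
        simp only [traceRight, Matrix.of_apply, Matrix.mul_apply, Fintype.sum_prod_type,
          Matrix.conjTranspose_apply, Matrix.kroneckerMap_apply, Finset.sum_mul, Finset.mul_sum]
        rw [Finset.sum_comm]
        refine Finset.sum_congr rfl fun x' _ => ?_
        rw [Finset.sum_comm]
        refine Finset.sum_congr rfl fun y' _ => ?_
        rw [Finset.sum_comm]
        refine Finset.sum_congr rfl fun x _ => ?_
        rw [Finset.sum_comm]
        refine Finset.sum_congr rfl fun y _ => Finset.sum_congr rfl fun j _ => ?_
        rw [star_mul']
        ring
    _ = _ := by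
        simp only [hδ, mul_ite, mul_one, mul_zero, Finset.sum_ite_eq, Finset.mem_univ, if_true,
          traceRight, Matrix.of_apply, Matrix.mul_apply, Matrix.conjTranspose_apply,
          Finset.sum_mul, Finset.mul_sum]
        exact Finset.sum_congr rfl fun x' _ => Finset.sum_comm

lemma traceLeft_kronecker_conj [DecidableEq X] (ρ : Matrix (X × Y) (X × Y) ℂ) {U : Matrix X X ℂ}
    (V : Matrix Y Y ℂ) (hU : U * Uᴴ = 1) :
    traceLeft ((U ⊗ₖ V)ᴴ * ρ * (U ⊗ₖ V)) = Vᴴ * traceLeft ρ * V := by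
  rw [show Vᴴ * traceLeft ρ * V = Vᴴ * traceRight (ρ.submatrix Prod.swap Prod.swap) * V from rfl,
    ← traceRight_kronecker_conj _ V hU]
  ext i i'
  simp only [traceRight, traceLeft, Matrix.of_apply, Matrix.mul_apply, Fintype.sum_prod_type,
    Matrix.conjTranspose_apply, Matrix.kroneckerMap_apply, Matrix.submatrix_apply, Prod.swap_prod_mk]
  refine Finset.sum_congr rfl fun j _ => ?_
  rw [Finset.sum_comm]
  refine Finset.sum_congr rfl fun y' _ => Finset.sum_congr rfl fun x' _ => ?_
  rw [Finset.sum_comm, mul_comm (U x' j)]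
  simp only [mul_comm (U _ _)]

/-- **Subadditivity** of the von Neumann entropy. -/
theorem vnEntropy_le_traceRight_add_traceLeft [DecidableEq X] [DecidableEq Y]
    {ρ : Matrix (X × Y) (X × Y) ℂ} (hρ : ρ.PosSemidef) (htr : ρ.trace = 1) :
    vnEntropy ρ ≤ vnEntropy (traceRight ρ) + vnEntropy (traceLeft ρ) := by
  have hX := isHermitian_traceRight hρ.isHermitian
  have hY := isHermitian_traceLeft hρ.isHermitian
  set a := hX.eigenvalues with ha
  set r := hY.eigenvalues with hr
  set U : Matrix X X ℂ := ↑hX.eigenvectorUnitary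
  set V : Matrix Y Y ℂ := ↑hY.eigenvectorUnitary
  have hUU : U * Uᴴ = 1 := Unitary.coe_mul_star_self hX.eigenvectorUnitary
  have hVV : V * Vᴴ = 1 := Unitary.coe_mul_star_self hY.eigenvectorUnitary
  have hUVUV : (U ⊗ₖ V) * (U ⊗ₖ V)ᴴ = 1 := by
    rw [Matrix.conjTranspose_kronecker, ← Matrix.mul_kronecker_mul, hUU, hVV,
      Matrix.one_kronecker_one]
  set σ := (U ⊗ₖ V)ᴴ * ρ * (U ⊗ₖ V) with hσ
  have hσpos : σ.PosSemidef := hρ.conjTranspose_mul_mul_same _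
  have hσtr : σ.trace = 1 := by
    rw [hσ, Matrix.trace_mul_comm, ← mul_assoc, hUVUV, one_mul, htr]
  have hdX : Uᴴ * traceRight ρ * U = Matrix.diagonal fun i => (a i : ℂ) := by
    simpa [Unitary.conjStarAlgAut_star_apply] using! hX.conjStarAlgAut_star_eigenvectorUnitary
  have hdY : Vᴴ * traceLeft ρ * V = Matrix.diagonal fun i => (r i : ℂ) := by
    simpa [Unitary.conjStarAlgAut_star_apply] using! hY.conjStarAlgAut_star_eigenvectorUnitary
  rw [← traceRight_kronecker_conj ρ U hVV] at hdX
  rw [← traceLeft_kronecker_conj ρ V hUU] at hdY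
  let p : X → Y → ℝ := fun i j => (σ (i, j) (i, j)).re
  have hp0 : ∀ i j, 0 ≤ p i j := fun i j => (Complex.le_def.1 hσpos.diag_nonneg).1
  have hpa (i : X) : ∑ j, p i j = a i := by
    simpa [traceRight, p] using congrArg Complex.re (congrFun (congrFun hdX i) i)
  have hpr (j : Y) : ∑ i, p i j = r j := by
    simpa [traceLeft, p] using congrArg Complex.re (congrFun (congrFun hdY j) j)
  have ha0 (i : X) : 0 ≤ a i := hpa i ▸ Finset.sum_nonneg fun j _ => hp0 i j
  have hr0 (j : Y) : 0 ≤ r j := hpr j ▸ Finset.sum_nonneg fun i _ => hp0 i j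
  have hpa0 (i : X) (j : Y) (h : a i = 0) : p i j = 0 := by
    rw [← hpa, Finset.sum_eq_zero_iff_of_nonneg fun j _ => hp0 i j] at h
    exact h j (Finset.mem_univ j)
  have hpr0 (i : X) (j : Y) (h : r j = 0) : p i j = 0 := by
    rw [← hpr, Finset.sum_eq_zero_iff_of_nonneg fun i _ => hp0 i j] at h
    exact h i (Finset.mem_univ i)
  have hsa : ∑ i, a i = 1 := by
    have := hX.trace_eq_sum_eigenvalues
    rw [trace_traceRight, htr] at this
    exact Complex.ofReal_injective (by simpa using this.symm)
  have hsr : ∑ j, r j = 1 := by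
    have := hY.trace_eq_sum_eigenvalues
    rw [trace_traceLeft, htr] at this
    exact Complex.ofReal_injective (by simpa using this.symm)
  have key := vnEntropy_le_neg_sum_diag_mul_log hσpos (q := fun z => a z.1 * r z.2)
    (fun z => mul_nonneg (ha0 _) (hr0 _))
    (by simp [hσtr, Fintype.sum_prod_type, ← Finset.mul_sum, hsr, hsa])
    (fun z hz => (mul_eq_zero.1 hz).elim (hpa0 z.1 z.2) (hpr0 z.1 z.2))
  rw [vnEntropy_unitary_conj hρ.isHermitian hUVUV] at key
  refine key.trans_eq ?_
  have hsplit (i : X) (j : Y) :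
      p i j * Real.log (a i * r j) = p i j * Real.log (a i) + p i j * Real.log (r j) := by
    by_cases h1 : a i = 0
    · simp [hpa0 i j h1]
    by_cases h2 : r j = 0
    · simp [hpr0 i j h2]
    rw [Real.log_mul h1 h2, mul_add]
  have h1 : ∑ i, ∑ j, p i j * Real.log (a i) = -vnEntropy (traceRight ρ) := by
    simp [← Finset.sum_mul, hpa, vnEntropy, dif_pos hX, Real.negMulLog, ← ha]
  have h2 : ∑ i, ∑ j, p i j * Real.log (r j) = -vnEntropy (traceLeft ρ) := by
    rw [Finset.sum_comm]
    simp [← Finset.sum_mul, hpr, vnEntropy, dif_pos hY, Real.negMulLog, ← hr]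
  change -∑ z : X × Y, p z.1 z.2 * Real.log (a z.1 * r z.2) = _
  rw [Fintype.sum_prod_type]
  simp_rw [hsplit, Finset.sum_add_distrib, h1, h2]
  ring

end PartialTrace

section PureState

lemma pureDensity_apply {n : Type*} (ψ : n → ℂ) (u v : n) :
    pureDensity ψ u v = ψ u * star (ψ v) := rfl

lemma redAR_pureDensity_posSemidef (ψ : Q × A × B × R → ℂ) :
    (redAR (pureDensity ψ)).PosSemidef := by
  let M : Matrix (A × R) (Q × B) ℂ := Matrix.of fun p z => ψ (z.1, p.1, z.2, p.2)
  have : redAR (pureDensity ψ) = M * Mᴴ := by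
    ext p q
    simp [redAR, pureDensity_apply, M, Matrix.mul_apply, Fintype.sum_prod_type]
  exact this ▸ Matrix.posSemidef_self_mul_conjTranspose M

lemma redBR_pureDensity_posSemidef (ψ : Q × A × B × R → ℂ) :
    (redBR (pureDensity ψ)).PosSemidef := by
  let M : Matrix (B × R) (Q × A) ℂ := Matrix.of fun p z => ψ (z.1, z.2, p.1, p.2)
  have : redBR (pureDensity ψ) = M * Mᴴ := by
    ext p q
    simp [redBR, pureDensity_apply, M, Matrix.mul_apply, Fintype.sum_prod_type]
  exact this ▸ Matrix.posSemidef_self_mul_conjTranspose M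

lemma trace_redAR (ρ : Matrix (Q × A × B × R) (Q × A × B × R) ℂ) :
    (redAR ρ).trace = ρ.trace := by
  simp only [redAR, Matrix.trace, Matrix.diag_apply, Matrix.of_apply, Fintype.sum_prod_type]
  simp only [Finset.sum_comm (s := (Finset.univ : Finset R))]
  rw [Finset.sum_comm]

lemma trace_redBR (ρ : Matrix (Q × A × B × R) (Q × A × B × R) ℂ) :
    (redBR ρ).trace = ρ.trace := by
  simp only [redBR, Matrix.trace, Matrix.diag_apply, Matrix.of_apply, Fintype.sum_prod_type]
  simp only [Finset.sum_comm (s := (Finset.univ : Finset R))]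
  rw [Finset.sum_comm]
  refine Finset.sum_congr rfl fun x _ => Finset.sum_comm

lemma trace_pureDensity {n : Type*} [Fintype n] {ψ : n → ℂ} (h : ∑ v, ‖ψ v‖ ^ 2 = 1) :
    (pureDensity ψ).trace = 1 := by
  simp only [Matrix.trace, Matrix.diag_apply, pureDensity_apply, Complex.star_def,
    Complex.mul_conj']
  exact_mod_cast h

lemma traceLeft_redAR {R : Type*} (ρ : Matrix (Q × A × B × R) (Q × A × B × R) ℂ) :
    traceLeft (redAR ρ) = redR ρ := by
  ext p q
  exact Finset.sum_comm

lemma traceLeft_redBR {R : Type*} (ρ : Matrix (Q × A × B × R) (Q × A × B × R) ℂ) :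
    traceLeft (redBR ρ) = redR ρ := by
  ext p q
  simp only [traceLeft, redBR, redR, Matrix.of_apply]
  rw [Finset.sum_comm]
  exact Finset.sum_congr rfl fun x _ => Finset.sum_comm

variable [DecidableEq Q] [DecidableEq A] [DecidableEq B] [DecidableEq R]

lemma vnEntropy_redQBR_pureDensity (ψ : Q × A × B × R → ℂ) :
    vnEntropy (redQBR (pureDensity ψ)) = vnEntropy (traceRight (redAR (pureDensity ψ))) := by
  let M : Matrix A (Q × B × R) ℂ := Matrix.of fun a z => ψ (z.1, a, z.2)
  have h1 : traceRight (redAR (pureDensity ψ)) = M * Mᴴ := by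
    ext p q
    simp only [traceRight, redAR, pureDensity_apply, M, Matrix.mul_apply, Fintype.sum_prod_type,
      Matrix.of_apply, Matrix.conjTranspose_apply]
    rw [Finset.sum_comm]
    exact Finset.sum_congr rfl fun x _ => Finset.sum_comm
  have h2 : redQBR (pureDensity ψ) = (Mᴴ * M)ᵀ := by
    ext p q
    simp [redQBR, pureDensity_apply, M, Matrix.mul_apply, mul_comm]
  rw [h1, h2, vnEntropy_transpose (Matrix.isHermitian_conjTranspose_mul_self M),
    vnEntropy_mul_conjTranspose_self]

lemma vnEntropy_redQAR_pureDensity (ψ : Q × A × B × R → ℂ) :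
    vnEntropy (redQAR (pureDensity ψ)) = vnEntropy (traceRight (redBR (pureDensity ψ))) := by
  let M : Matrix B (Q × A × R) ℂ := Matrix.of fun b z => ψ (z.1, z.2.1, b, z.2.2)
  have h1 : traceRight (redBR (pureDensity ψ)) = M * Mᴴ := by
    ext p q
    simp only [traceRight, redBR, pureDensity_apply, M, Matrix.mul_apply, Fintype.sum_prod_type,
      Matrix.of_apply, Matrix.conjTranspose_apply]
    rw [Finset.sum_comm]
    exact Finset.sum_congr rfl fun x _ => Finset.sum_comm
  have h2 : redQAR (pureDensity ψ) = (Mᴴ * M)ᵀ := by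
    ext p q
    simp [redQAR, pureDensity_apply, M, Matrix.mul_apply, mul_comm]
  rw [h1, h2, vnEntropy_transpose (Matrix.isHermitian_conjTranspose_mul_self M),
    vnEntropy_mul_conjTranspose_self]

end PureState

/-- Suppose a routing protocol produces a pure state `ψ` on `Q̄ A B R`
with `ψ_{Q̄}` maximally mixed of dimension `d = card Q̄`, such that both
`I(Q̄:AR) = 2 log d` and `I(Q̄:BR) = 2 log d`.  Then `S(R) ≥ log d`. -/
theorem routing_entropy_lower_bound
    [DecidableEq Q] [DecidableEq A] [DecidableEq B] [DecidableEq R]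
    (ψ : Q × A × B × R → ℂ) (hψ : ∑ v, ‖ψ v‖ ^ 2 = 1)
    (hmix : redQ (pureDensity ψ) = ((Fintype.card Q : ℂ))⁻¹ • (1 : Matrix Q Q ℂ))
    (hA : vnEntropy (redQ (pureDensity ψ)) + vnEntropy (redAR (pureDensity ψ))
        - vnEntropy (redQAR (pureDensity ψ)) = 2 * Real.log (Fintype.card Q))
    (hB : vnEntropy (redQ (pureDensity ψ)) + vnEntropy (redBR (pureDensity ψ))
        - vnEntropy (redQBR (pureDensity ψ)) = 2 * Real.log (Fintype.card Q)) :
    Real.log (Fintype.card Q) ≤ vnEntropy (redR (pureDensity ψ)) := by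
  have hAR := vnEntropy_le_traceRight_add_traceLeft (redAR_pureDensity_posSemidef ψ)
    (by rw [trace_redAR, trace_pureDensity hψ])
  have hBR := vnEntropy_le_traceRight_add_traceLeft (redBR_pureDensity_posSemidef ψ)
    (by rw [trace_redBR, trace_pureDensity hψ])
  rw [traceLeft_redAR, ← vnEntropy_redQBR_pureDensity] at hAR
  rw [traceLeft_redBR, ← vnEntropy_redQAR_pureDensity] at hBR
  rw [hmix, vnEntropy_inv_card_smul_one] at hA hB
  linarith

end QI
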